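/- arXiv:2602.03251 — 2 statements merged into one kernel-verified Lean document; each statement's English description precedes it below -/
import Mathlib

section
/- The only rational solutions (x, y) ∈ ℚ² of the equation y² = x(x² + 14x + 1) are (0,0), (1,4) and (1,−4). Equivalently, the elliptic curve C₄ : y² = x³ + 14x² + x has exactly four rational points: the point at infinity, (0,0), (1,4) and (1,−4). -/
lemma c4_congr {a a' b b' : ℤ} (h : IsCoprime a b) (e : a' = a) (f : b' = b) :
    IsCoprime a' b' := by
  rw [e, f]; exact h

lemma c4_four (k n p q : ℤ) (hk : k ≠ 0) (h : k * n = p * q) :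
    ∃ α β γ δ : ℤ, k = α * β ∧ n = γ * δ ∧ p = α * γ ∧ q = β * δ := by
  obtain ⟨α, β, ⟨γ, hγ⟩, ⟨δ, hδ⟩, hab⟩ := exists_dvd_and_dvd_of_dvd_mul (Dvd.intro n h)
  refine ⟨α, β, γ, δ, hab, ?_, hγ, hδ⟩
  apply mul_left_cancel₀ hk
  rw [h, hγ, hδ, hab]; ring

lemma c4_three (a d : ℤ) (h : (3 : ℤ) ∣ a ^ 2 + d ^ 2) : (3 : ℤ) ∣ a ∧ (3 : ℤ) ∣ d := by
  have ha : a % 3 = 0 ∨ a % 3 = 1 ∨ a % 3 = 2 := by omega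
  have hd : d % 3 = 0 ∨ d % 3 = 1 ∨ d % 3 = 2 := by omega
  have h' := Int.emod_eq_zero_of_dvd h
  rcases ha with ha | ha | ha <;> rcases hd with hd | hd | hd <;>
    simp [pow_two, Int.add_emod, Int.mul_emod, ha, hd] at h' <;> omega

lemma c4_cop (a d : ℤ) (h : IsCoprime a d) :
    IsCoprime (4 * a ^ 2 + d ^ 2) (a ^ 2 + d ^ 2) := by
  have h3 : IsCoprime (3 : ℤ) (a ^ 2 + d ^ 2) := by
    rw [Prime.coprime_iff_not_dvd Int.prime_three]
    intro h'
    obtain ⟨h1, h2⟩ := c4_three a d h'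
    have := h.isUnit_of_dvd' h1 h2
    rw [Int.isUnit_iff] at this
    omega
  have ha : IsCoprime (a ^ 2) (a ^ 2 + d ^ 2) := by
    have : IsCoprime (a ^ 2) (d ^ 2) := h.pow
    simpa [add_comm] using this.add_mul_left_right 1
  have h4 := (h3.mul_left ha).add_mul_left_left 1
  exact c4_congr (h4) (by ring) (by ring)

lemma c4_step (k n p q : ℤ) (hk : k ≠ 0) (hn : n % 2 = 1) (hkn : IsCoprime k n)
    (hpq : IsCoprime p q) (h1 : k * n = p * q) (h2 : 4 * k ^ 2 - n ^ 2 = p ^ 2 - q ^ 2) :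
    ∃ r s z : ℤ, IsCoprime r s ∧ (r + s) % 2 = 1 ∧ r * s ≠ 0 ∧
      (r * s).natAbs < (p * q).natAbs ∧ r ^ 4 + 14 * r ^ 2 * s ^ 2 + s ^ 4 = z ^ 2 := by
  obtain ⟨α, β, γ, δ, rfl, rfl, rfl, rfl⟩ := c4_four k n p q hk h1
  have hα : α ≠ 0 := left_ne_zero_of_mul hk
  have hβ : β ≠ 0 := right_ne_zero_of_mul hk
  have hγδ : γ * δ ≠ 0 := by intro h; rw [h] at hn; simp at hn
  have hβγ : IsCoprime β γ := hkn.of_mul_left_right.of_mul_right_left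
  have hαδ : IsCoprime α δ := hkn.of_mul_left_left.of_mul_right_right
  have hc := c4_cop α δ hαδ
  have he : β ^ 2 * (4 * α ^ 2 + δ ^ 2) = γ ^ 2 * (α ^ 2 + δ ^ 2) := by linarith
  have hbg : IsCoprime (β ^ 2) (γ ^ 2) := hβγ.pow
  have d1 : β ^ 2 ∣ α ^ 2 + δ ^ 2 := hbg.dvd_of_dvd_mul_left (Dvd.intro _ he)
  have d2 : α ^ 2 + δ ^ 2 ∣ β ^ 2 :=
    hc.symm.dvd_of_dvd_mul_right (Dvd.intro_left _ he.symm)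
  have e1 : α ^ 2 + δ ^ 2 = β ^ 2 :=
    Int.dvd_antisymm (by positivity) (by positivity) d2 d1
  have e2 : 4 * α ^ 2 + δ ^ 2 = γ ^ 2 := by
    rw [e1] at he
    apply mul_left_cancel₀ (pow_ne_zero 2 hβ)
    linarith
  have hδ : δ % 2 = 1 := by
    rcases Int.emod_two_eq_zero_or_one δ with h | h
    · simp [Int.mul_emod, h] at hn
    · exact h
  have hpt : PythagoreanTriple δ α |β| := by
    unfold PythagoreanTriple
    rw [abs_mul_abs_self]; linarith
  obtain ⟨r, s, hr, hs, -, hg, hpar, -⟩ := hpt.coprime_classification'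
    (Int.isCoprime_iff_gcd_eq_one.mp hαδ.symm) hδ (abs_pos.mpr hβ)
  refine ⟨r, s, γ, Int.isCoprime_iff_gcd_eq_one.mpr hg, by omega, ?_, ?_, ?_⟩
  · intro h; apply hα; rw [hs]; linarith
  · have hrs : r * s ≠ 0 := by intro h; apply hα; rw [hs]; linarith
    have h1 : α * γ * (β * δ) = (r * s) * (2 * (β * (γ * δ))) := by rw [hs]; ring
    rw [h1, Int.natAbs_mul (r * s)]
    have h2 : 0 < (r * s).natAbs := Int.natAbs_pos.mpr hrs
    have h3 : 0 < (β * (γ * δ)).natAbs := Int.natAbs_pos.mpr (mul_ne_zero hβ hγδ)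
    have h4 : 1 < (2 * (β * (γ * δ))).natAbs := by
      omega
    exact lt_mul_of_one_lt_right h2 h4
  · rw [← e2, hs, hr]; ring

lemma c4_cop2 (p q : ℤ) (h : IsCoprime p q) : IsCoprime (p ^ 2 - q ^ 2) (p * q) := by
  have h1 : IsCoprime (p ^ 2 - q ^ 2) p := by
    have : IsCoprime (-q ^ 2) p := (h.symm.pow_left).neg_left
    exact c4_congr (this.add_mul_left_left p) (by ring) (by ring)
  have h2 : IsCoprime (p ^ 2 - q ^ 2) q := by
    have : IsCoprime (p ^ 2) q := h.pow_left
    exact c4_congr (this.add_mul_left_left (-q)) (by ring) (by ring)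
  exact h1.mul_right h2

lemma c4_odd_sq (p q : ℤ) (h : (p + q) % 2 = 1) : (p ^ 2 - q ^ 2) % 2 = 1 := by
  have : p ^ 2 - q ^ 2 = (p + q) * (p - q) := by ring
  rw [this, Int.mul_emod, h, show (p - q) % 2 = 1 by omega]; rfl

lemma c4_odd_cop (a : ℤ) (h : a % 2 = 1) : IsCoprime a 2 := by
  refine ⟨1, -(a / 2), ?_⟩
  omega

lemma c4_desc (N : ℕ) : ∀ p q z : ℤ, (p * q).natAbs = N → IsCoprime p q → (p + q) % 2 = 1 →
    p * q ≠ 0 → p ^ 4 + 14 * p ^ 2 * q ^ 2 + q ^ 4 = z ^ 2 → False := by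
  induction N using Nat.strong_induction_on with
  | _ N ih =>
  intro p q z hN hc hpar h0 he
  have hz : z ≠ 0 := by
    rintro rfl
    have : 0 < (p * q) ^ 2 := by positivity
    nlinarith [sq_nonneg (p ^ 2), sq_nonneg (q ^ 2)]
  have hodd := c4_odd_sq p q hpar
  have hpt : PythagoreanTriple (p ^ 2 - q ^ 2) (4 * (p * q)) |z| := by
    unfold PythagoreanTriple
    rw [abs_mul_abs_self]; linarith
  have hcop : IsCoprime (p ^ 2 - q ^ 2) (4 * (p * q)) := by
    have h2 := c4_odd_cop _ hodd
    have h4 := (h2.mul_right h2).mul_right (c4_cop2 p q hc)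
    norm_num at h4
    exact h4
  obtain ⟨m, n, hm, hn, -, hg, hpm, -⟩ := hpt.coprime_classification'
    (Int.isCoprime_iff_gcd_eq_one.mp hcop) hodd (abs_pos.mpr hz)
  have hmn : IsCoprime m n := Int.isCoprime_iff_gcd_eq_one.mpr hg
  have key : ∃ r s z : ℤ, IsCoprime r s ∧ (r + s) % 2 = 1 ∧ r * s ≠ 0 ∧
      (r * s).natAbs < (p * q).natAbs ∧ r ^ 4 + 14 * r ^ 2 * s ^ 2 + s ^ 4 = z ^ 2 := by
    rcases hpm with ⟨h1, h2⟩ | ⟨h1, h2⟩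
    · obtain ⟨k, rfl⟩ := Int.dvd_of_emod_eq_zero h1
      apply c4_step k n p q _ h2 hmn.of_mul_left_right hc (by linarith) (by linarith)
      rintro rfl
      apply h0; linarith
    · obtain ⟨k, rfl⟩ := Int.dvd_of_emod_eq_zero h2
      rw [mul_comm p q]
      apply c4_step k m q p _ h1 hmn.symm.of_mul_left_right hc.symm (by linarith) (by linarith)
      rintro rfl
      apply h0; linarith
  obtain ⟨r, s, w, h1, h2, h3, h4, h5⟩ := key
  exact ih _ (hN ▸ h4) r s w rfl h1 h2 h3 h5

lemma c4_int (p q z : ℤ) (hc : IsCoprime p q) (h0 : p * q ≠ 0)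
    (he : p ^ 4 + 14 * p ^ 2 * q ^ 2 + q ^ 4 = z ^ 2) : p ^ 2 = q ^ 2 := by
  by_cases hpar : (p + q) % 2 = 1
  · exact (c4_desc _ p q z rfl hc hpar h0 he).elim
  obtain ⟨A, hA⟩ : (2 : ℤ) ∣ p + q := by omega
  obtain ⟨B, hB⟩ : ∃ B, B = A - q := ⟨_, rfl⟩
  obtain rfl : q = A - B := by linarith
  obtain rfl : p = A + B := by linarith
  have hAB : IsCoprime A B := by
    obtain ⟨u, v, huv⟩ := hc
    exact ⟨u + v, u - v, by linarith⟩
  have hparAB : (A + B) % 2 = 1 := by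
    by_contra h
    have := hc.isUnit_of_dvd' (show (2 : ℤ) ∣ A + B by omega) (show (2 : ℤ) ∣ A - B by omega)
    rw [Int.isUnit_iff] at this
    omega
  obtain ⟨w, rfl⟩ : (4 : ℤ) ∣ z := by
    have : (4 : ℤ) ^ 2 ∣ z ^ 2 := ⟨A ^ 4 - A ^ 2 * B ^ 2 + B ^ 4, by rw [← he]; ring⟩
    exact (Int.pow_dvd_pow_iff two_ne_zero).mp this
  have he' : (A ^ 2 - B ^ 2) ^ 2 + (A * B) ^ 2 = w ^ 2 := by linarith
  by_contra hne
  have hAB0 : A * B ≠ 0 := by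
    intro h; apply hne; linarith
  have hw : w ≠ 0 := by
    rintro rfl
    have : 0 < (A * B) ^ 2 := by positivity
    nlinarith [sq_nonneg (A ^ 2 - B ^ 2)]
  have hpt : PythagoreanTriple (A ^ 2 - B ^ 2) (A * B) |w| := by
    unfold PythagoreanTriple
    rw [abs_mul_abs_self]; linarith
  obtain ⟨m, n, hm, hn, -, hg, hpm, -⟩ := hpt.coprime_classification'
    (Int.isCoprime_iff_gcd_eq_one.mp (c4_cop2 A B hAB)) (c4_odd_sq A B hparAB) (abs_pos.mpr hw)
  refine c4_desc _ m n (A ^ 2 + B ^ 2) rfl (Int.isCoprime_iff_gcd_eq_one.mpr hg) (by omega) ?_ ?_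
  · intro h; apply hAB0; linarith
  · have : (A ^ 2 + B ^ 2) ^ 2 = (A ^ 2 - B ^ 2) ^ 2 + 4 * (A * B) ^ 2 := by ring
    rw [this, hm, hn]; ring

lemma c4_neg (p q t : ℤ) (hc : IsCoprime p q)
    (he : p ^ 4 - 14 * p ^ 2 * q ^ 2 + q ^ 4 = - t ^ 2) : False := by
  have h1 : (p ^ 2 - q ^ 2) ^ 2 + t ^ 2 = 3 * (4 * p ^ 2 * q ^ 2) := by linarith
  obtain ⟨⟨a, ha⟩, b, hb⟩ := c4_three _ _ (Dvd.intro _ h1.symm)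
  have h2 : (3 : ℤ) ∣ 4 * (p * q) ^ 2 := ⟨a ^ 2 + b ^ 2, by rw [ha, hb] at h1; linarith⟩
  have h3 : (3 : ℤ) ∣ (p * q) ^ 2 := by omega
  have h4 := Int.prime_three.dvd_of_dvd_pow h3
  have := (c4_cop2 p q hc).isUnit_of_dvd' ⟨a, ha⟩ h4
  rw [Int.isUnit_iff] at this
  omega

lemma c4_ab (a b w : ℤ) (hb : 0 < b) (ha : a ≠ 0) (hc : IsCoprime a b)
    (h : (a * b) * (a ^ 2 + 14 * (a * b) + b ^ 2) = w ^ 2) : a = b := by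
  have hT : IsCoprime (a * b) (a ^ 2 + 14 * (a * b) + b ^ 2) := by
    have h1 : IsCoprime (a * b) (a ^ 2 + b ^ 2) := by
      apply IsCoprime.mul_left
      · have : IsCoprime a (b ^ 2) := hc.pow_right
        exact c4_congr (this.add_mul_left_right a) (by ring) (by ring)
      · have : IsCoprime b (a ^ 2) := hc.symm.pow_right
        exact c4_congr (this.add_mul_left_right b) (by ring) (by ring)
    exact c4_congr (h1.add_mul_left_right 14) (by ring) (by ring)
  obtain ⟨s, hs⟩ := Int.sq_of_isCoprime hT h
  obtain ⟨t, ht⟩ := Int.sq_of_isCoprime hT.symm (by rw [mul_comm]; exact h)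
  obtain ⟨q, hq⟩ : ∃ q, b = q ^ 2 := by
    have : ∃ q, b = q ^ 2 ∨ b = - q ^ 2 := by
      rcases hs with hs | hs
      · exact Int.sq_of_isCoprime hc.symm (by rw [mul_comm]; exact hs)
      · obtain ⟨q, hq⟩ := Int.sq_of_isCoprime (a := b) (b := -a) (c := s) hc.symm.neg_right (by linarith)
        exact ⟨q, hq⟩
    obtain ⟨q, hq | hq⟩ := this
    · exact ⟨q, hq⟩
    · nlinarith [sq_nonneg q]
  have hp : ∃ p, a = p ^ 2 ∨ a = - p ^ 2 := by
    rcases hs with hs | hs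
    · exact Int.sq_of_isCoprime hc hs
    · exact Int.sq_of_isCoprime (a := a) (b := -b) (c := s) hc.neg_right (by linarith)
  obtain ⟨p, hp⟩ := hp
  subst hq
  have hq0 : q ≠ 0 := by rintro rfl; simp at hb
  have hp0 : p ≠ 0 := by rintro rfl; simp at hp; exact ha hp
  rcases hp with rfl | rfl
  · have hpq : IsCoprime p q := (IsCoprime.pow_iff two_pos two_pos).mp hc
    rcases ht with ht | ht
    · exact c4_int p q t hpq (mul_ne_zero hp0 hq0) (by linarith)
    · exfalso
      have : 0 < (p ^ 2) ^ 2 + 14 * (p ^ 2 * q ^ 2) + (q ^ 2) ^ 2 := by positivity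
      nlinarith [sq_nonneg t]
  · exfalso
    have hpq : IsCoprime p q := (IsCoprime.pow_iff two_pos two_pos).mp (by simpa using hc.neg_left)
    rcases ht with ht | ht
    · have ht0 : t = 0 := by
        by_contra h0
        rw [ht] at h
        have : 0 < p ^ 2 * q ^ 2 * t ^ 2 := by positivity
        nlinarith [sq_nonneg w]
      exact c4_neg p q t hpq (by subst ht0; linarith)
    · exact c4_neg p q t hpq (by linarith)

theorem rational_points_of_C4 (x y : ℚ) (h : y ^ 2 = x * (x ^ 2 + 14 * x + 1)) :
    (x = 0 ∧ y = 0) ∨ (x = 1 ∧ y = 4) ∨ (x = 1 ∧ y = -4) := by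
  by_cases hx : x = 0
  · left; subst hx; simpa using h
  right
  have hx1 : x = 1 := by
    have hd : (x.den : ℚ) ≠ 0 := by exact_mod_cast x.den_nz
    have hxe : x * x.den = x.num := Rat.mul_den_eq_num x
    have hsq : IsSquare (((x.num * x.den) * (x.num ^ 2 + 14 * (x.num * x.den) + (x.den : ℤ) ^ 2) : ℤ) : ℚ) := by
      refine ⟨y * x.den ^ 2, ?_⟩
      push_cast
      rw [← hxe]
      linear_combination (-(x.den : ℚ) ^ 4) * h
    rw [Rat.isSquare_intCast_iff] at hsq
    obtain ⟨w, hw⟩ := hsq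
    have := c4_ab x.num x.den w (by exact_mod_cast x.den_pos) (Rat.num_ne_zero.mpr hx)
      (Rat.isCoprime_num_den x) (by rw [hw]; ring)
    have h2 : (x.num : ℚ) = x.den := by exact_mod_cast this
    rw [h2] at hxe
    exact mul_right_cancel₀ hd (by rw [hxe, one_mul])
  subst hx1
  have : (y - 4) * (y + 4) = 0 := by linarith
  rcases mul_eq_zero.mp this with h | h
  · left; exact ⟨rfl, by linarith⟩
  · right; exact ⟨rfl, by linarith⟩
end

section
/- The only rational solutions (x, y) ∈ ℚ² of the equation y² = x⁴ + 14x² + 1 are (0,1), (0,−1), (1,4), (1,−4), (−1,4) and (−1,−4). -/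
/-- Pythagorean parametrisation without a sign condition on the hypotenuse. -/
lemma pyth_aux {p s r : ℤ} (h : p ^ 2 + s ^ 2 = r ^ 2) (hc : IsCoprime p s) (hp : p % 2 = 1) :
    ∃ m n : ℤ, p = m ^ 2 - n ^ 2 ∧ s = 2 * m * n ∧ IsCoprime m n ∧
      (m % 2 = 0 ∧ n % 2 = 1 ∨ m % 2 = 1 ∧ n % 2 = 0) := by
  have hr : r ≠ 0 := by
    rintro rfl
    have : p = 0 := by nlinarith [sq_nonneg p, sq_nonneg s]
    omega
  have ht : PythagoreanTriple p s |r| := by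
    unfold PythagoreanTriple
    rw [abs_mul_abs_self]
    linarith
  obtain ⟨m, n, h1, h2, -, h4, h5, -⟩ :=
    ht.coprime_classification' (Int.isCoprime_iff_gcd_eq_one.mp hc) hp (abs_pos.mpr hr)
  exact ⟨m, n, h1, h2, Int.isCoprime_iff_gcd_eq_one.mpr h4, h5⟩

lemma odd_sub_sq {a b : ℤ} (hab : a % 2 = 0 ∧ b % 2 = 1 ∨ a % 2 = 1 ∧ b % 2 = 0) :
    (a ^ 2 - b ^ 2) % 2 = 1 := by
  rcases hab with ⟨h1, h2⟩ | ⟨h1, h2⟩ <;>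
    simp [pow_two, Int.sub_emod, Int.mul_emod, h1, h2]

lemma cop_sub_sq {a b : ℤ} (hc : IsCoprime a b) : IsCoprime (a ^ 2 - b ^ 2) (a * b) := by
  apply IsCoprime.mul_right
  · have h : IsCoprime (-b ^ 2) a := (hc.symm.pow_left (m := 2)).neg_left
    have e : a ^ 2 - b ^ 2 = -b ^ 2 + a * a := by ring
    rw [e]
    exact h.add_mul_left_left a
  · have h : IsCoprime (a ^ 2) b := hc.pow_left
    have e : a ^ 2 - b ^ 2 = a ^ 2 + b * (-b) := by ring
    rw [e]
    exact h.add_mul_left_left (-b)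

lemma quartic_to_system {a b c : ℤ} (hc : IsCoprime a b)
    (hab : a % 2 = 0 ∧ b % 2 = 1 ∨ a % 2 = 1 ∧ b % 2 = 0)
    (h : (a ^ 2 - b ^ 2) ^ 2 + (4 * (a * b)) ^ 2 = c ^ 2) :
    ∃ x w a' b' : ℤ, x % 2 = 1 ∧ IsCoprime a' b' ∧ x * w = a' * b' ∧
      x ^ 2 - 4 * w ^ 2 = a' ^ 2 - b' ^ 2 ∧ a' * b' = a * b := by
  have ho := odd_sub_sq hab
  have h2 : IsCoprime (a ^ 2 - b ^ 2) 2 :=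
    ⟨1, -((a ^ 2 - b ^ 2) / 2), by omega⟩
  have h4 : IsCoprime (a ^ 2 - b ^ 2) (4 * (a * b)) := by
    have : (4 : ℤ) = 2 * 2 := by norm_num
    rw [this]
    exact (h2.mul_right h2).mul_right (cop_sub_sq hc)
  obtain ⟨m, n, e1, e2, -, e4⟩ := pyth_aux h h4 ho
  rcases e4 with ⟨hm, hn⟩ | ⟨hm, hn⟩
  · obtain ⟨w, rfl⟩ : (2 : ℤ) ∣ m := Int.dvd_of_emod_eq_zero hm
    exact ⟨n, w, b, a, hn, hc.symm, by linarith, by linarith, by ring⟩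
  · obtain ⟨w, rfl⟩ : (2 : ℤ) ∣ n := Int.dvd_of_emod_eq_zero hn
    exact ⟨m, w, a, b, hm, hc, by linarith, by linarith, by ring⟩

/-- One step of the descent. -/
lemma descent_step {x w a b : ℤ} (hx : x % 2 = 1) (hc : IsCoprime a b) (h1 : x * w = a * b)
    (h2 : x ^ 2 - 4 * w ^ 2 = a ^ 2 - b ^ 2) (h0 : a * b ≠ 0) :
    ∃ x' w' a' b' : ℤ, x' % 2 = 1 ∧ IsCoprime a' b' ∧ x' * w' = a' * b' ∧
      x' ^ 2 - 4 * w' ^ 2 = a' ^ 2 - b' ^ 2 ∧ a' * b' ≠ 0 ∧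
      (a' * b').natAbs < (a * b).natAbs := by
  have hx0 : x ≠ 0 := by rintro rfl; omega
  have hg : 0 < Int.gcd x a := Int.gcd_pos_of_ne_zero_left _ hx0
  obtain ⟨q, r, hqr, hq, hr⟩ := Int.exists_gcd_one hg
  generalize (Int.gcd x a : ℤ) = p at hq hr
  subst hq hr
  have hp0 : p ≠ 0 := by rintro rfl; simp at hx0
  have hq0 : q ≠ 0 := by rintro rfl; simp at hx0
  have hr0 : r ≠ 0 := by rintro rfl; simp at h0
  have hqrc : IsCoprime q r := Int.isCoprime_iff_gcd_eq_one.mpr hqr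
  have e : q * w = r * b := by
    apply mul_left_cancel₀ hp0
    linarith
  obtain ⟨s, rfl⟩ : r ∣ w := hqrc.symm.dvd_of_dvd_mul_left ⟨b, e⟩
  obtain rfl : b = q * s := by
    apply mul_left_cancel₀ hr0
    linarith
  have hs0 : s ≠ 0 := by rintro rfl; simp at h0
  have hps : IsCoprime p s := (hc.of_mul_left_right).of_mul_right_right
  have hpo : p % 2 = 1 := by
    rcases Int.emod_two_eq_zero_or_one p with h | h
    · simp [Int.mul_emod, h] at hx
    · exact h
  have hqo : q % 2 = 1 := by
    rcases Int.emod_two_eq_zero_or_one q with h | h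
    · simp [Int.mul_emod, h] at hx
    · exact h
  have e2 : p ^ 2 * (q ^ 2 - r ^ 2) = s ^ 2 * (4 * r ^ 2 - q ^ 2) := by linarith
  obtain ⟨k, hk⟩ : p ^ 2 ∣ 4 * r ^ 2 - q ^ 2 := (hps.pow (m := 2) (n := 2)).dvd_of_dvd_mul_left ⟨_, e2.symm⟩
  have hk2 : q ^ 2 - r ^ 2 = s ^ 2 * k := by
    apply mul_left_cancel₀ (pow_ne_zero 2 hp0)
    rw [e2, hk]; ring
  have k1 : 3 * r ^ 2 = k * (p ^ 2 + s ^ 2) := by linarith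
  have k2 : 3 * q ^ 2 = k * (p ^ 2 + 4 * s ^ 2) := by linarith
  have hk3 : k ∣ 3 := by
    obtain ⟨u, v, huv⟩ := hqrc.pow (m := 2) (n := 2)
    have : (3 : ℤ) = u * (3 * q ^ 2) + v * (3 * r ^ 2) := by linear_combination (-3) * huv
    rw [this, k1, k2]
    exact dvd_add ((dvd_mul_right k _).mul_left u)
      ((dvd_mul_right k _).mul_left v)
  have hkpos : 0 < k := by
    have : 0 < k * (p ^ 2 + s ^ 2) := by rw [← k1]; positivity
    exact pos_of_mul_pos_left this (by positivity)
  have hkle : k ≤ 3 := Int.le_of_dvd (by norm_num) hk3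
  obtain rfl | rfl | rfl : k = 1 ∨ k = 2 ∨ k = 3 := by omega
  · exfalso
    obtain ⟨p', rfl⟩ : ∃ t, p = 2 * t + 1 := ⟨p / 2, by omega⟩
    obtain ⟨q', rfl⟩ : ∃ t, q = 2 * t + 1 := ⟨q / 2, by omega⟩
    ring_nf at hk
    omega
  · norm_num at hk3
  have f1 : p ^ 2 + s ^ 2 = r ^ 2 := by linarith
  obtain ⟨m, n, rfl, rfl, hmn, hpar⟩ := pyth_aux f1 hps hpo
  have f2 : (m ^ 2 - n ^ 2) ^ 2 + (4 * (m * n)) ^ 2 = q ^ 2 := by linarith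
  obtain ⟨x', w', a', b', g1, g2, g3, g4, g5⟩ := quartic_to_system hmn hpar f2
  have hmn0 : m * n ≠ 0 := by
    intro h
    apply hs0
    rw [mul_assoc, h, mul_zero]
  refine ⟨x', w', a', b', g1, g2, g3, g4, by rwa [g5], ?_⟩
  rw [g5]
  have hlt : (m * n).natAbs < (2 * m * n).natAbs := by
    rw [mul_assoc]; omega
  refine hlt.trans_le (Nat.le_of_dvd (Int.natAbs_pos.mpr h0) (Int.natAbs_dvd_natAbs.mpr ?_))
  exact (dvd_mul_left _ q).mul_left _

lemma system_trivial (N : ℕ) : ∀ x w a b : ℤ, (a * b).natAbs = N → x % 2 = 1 → IsCoprime a b →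
    x * w = a * b → x ^ 2 - 4 * w ^ 2 = a ^ 2 - b ^ 2 → a * b = 0 := by
  induction N using Nat.strong_induction_on with
  | _ N ih =>
    intro x w a b hN hx hc h1 h2
    by_contra h0
    obtain ⟨x', w', a', b', g1, g2, g3, g4, g5, g6⟩ := descent_step hx hc h1 h2 h0
    exact g5 (ih _ (hN ▸ g6) x' w' a' b' rfl g1 g2 g3 g4)

lemma quartic_int {a b c : ℤ} (hc : IsCoprime a b) (h : c ^ 2 = a ^ 4 + 14 * a ^ 2 * b ^ 2 + b ^ 4) :
    a * b = 0 ∨ a = b ∨ a = -b := by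
  by_cases hpar : a % 2 = 0 ∧ b % 2 = 1 ∨ a % 2 = 1 ∧ b % 2 = 0
  · left
    obtain ⟨x', w', a', b', g1, g2, g3, g4, g5⟩ :=
      quartic_to_system (c := c) hc hpar (by linarith)
    rw [← g5]
    exact system_trivial _ x' w' a' b' rfl g1 g2 g3 g4
  right
  have hodd : a % 2 = 1 ∧ b % 2 = 1 := by
    by_contra hne
    have ha : (2 : ℤ) ∣ a := by omega
    have hb : (2 : ℤ) ∣ b := by omega
    have := hc.isUnit_of_dvd' ha hb
    norm_num [Int.isUnit_iff] at this
  obtain ⟨u, v, rfl, rfl⟩ : ∃ u v : ℤ, a = u + v ∧ b = u - v :=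
    ⟨(a + b) / 2, (a - b) / 2, by omega, by omega⟩
  have huv : IsCoprime u v := by
    obtain ⟨s, t, hst⟩ := hc
    exact ⟨s + t, s - t, by linarith⟩
  have h16 : c ^ 2 = 4 ^ 2 * (u ^ 4 - u ^ 2 * v ^ 2 + v ^ 4) := by linarith
  obtain ⟨z, rfl⟩ : (4 : ℤ) ∣ c := by
    rw [← Int.pow_dvd_pow_iff (n := 2) (by norm_num)]
    exact ⟨_, h16⟩
  have hz : (u ^ 2 - v ^ 2) ^ 2 + (u * v) ^ 2 = z ^ 2 := by linarith
  have hpar2 : u % 2 = 0 ∧ v % 2 = 1 ∨ u % 2 = 1 ∧ v % 2 = 0 := by omega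
  obtain ⟨m, n, e1, e2, e3, -⟩ := pyth_aux hz (cop_sub_sq huv) (odd_sub_sq hpar2)
  have hmn : m * n = 0 := by
    rcases hpar2 with ⟨hu, hv⟩ | ⟨hu, hv⟩
    · obtain ⟨w, rfl⟩ : (2 : ℤ) ∣ u := Int.dvd_of_emod_eq_zero hu
      rw [mul_comm]
      exact system_trivial _ v w n m rfl hv e3.symm (by linarith) (by linarith)
    · obtain ⟨w, rfl⟩ : (2 : ℤ) ∣ v := Int.dvd_of_emod_eq_zero hv
      exact system_trivial _ u w m n rfl hu e3 (by linarith) (by linarith)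
  have : u * v = 0 := by rw [e2, mul_assoc, hmn, mul_zero]
  rcases mul_eq_zero.mp this with rfl | rfl
  · right; ring
  · left; ring

theorem rational_points_of_C6 (x y : ℚ) (h : y ^ 2 = x ^ 4 + 14 * x ^ 2 + 1) :
    (x = 0 ∧ y = 1) ∨ (x = 0 ∧ y = -1) ∨ (x = 1 ∧ y = 4) ∨ (x = 1 ∧ y = -4) ∨
    (x = -1 ∧ y = 4) ∨ (x = -1 ∧ y = -4) := by
  have hd : (x.den : ℚ) ≠ 0 := by exact_mod_cast x.den_ne_zero
  have hx : x * x.den = x.num := Rat.mul_den_eq_num x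
  have hsq : IsSquare (((x.num ^ 4 + 14 * x.num ^ 2 * (x.den : ℤ) ^ 2 + (x.den : ℤ) ^ 4 : ℤ)) : ℚ) := by
    refine ⟨y * x.den ^ 2, ?_⟩
    push_cast
    rw [← hx]
    linear_combination (-(x.den : ℚ) ^ 4) * h
  rw [Rat.isSquare_intCast_iff] at hsq
  obtain ⟨c, hc⟩ := hsq
  have hcop : IsCoprime x.num (x.den : ℤ) := Rat.isCoprime_num_den x
  have key : x = 0 ∨ x = 1 ∨ x = -1 := by
    rcases quartic_int (c := c) hcop (by rw [hc]; ring) with h0 | h0 | h0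
    · left
      rcases mul_eq_zero.mp h0 with h0 | h0
      · exact Rat.num_eq_zero.mp h0
      · exact absurd (by exact_mod_cast h0) hd
    · right; left
      apply mul_right_cancel₀ hd
      rw [hx, h0]; simp
    · right; right
      apply mul_right_cancel₀ hd
      rw [hx, h0]; simp
  rcases key with rfl | rfl | rfl
  · have : (y - 1) * (y + 1) = 0 := by linarith
    rcases mul_eq_zero.mp this with h | h
    · left; exact ⟨rfl, by linarith⟩
    · right; left; exact ⟨rfl, by linarith⟩
  · have : (y - 4) * (y + 4) = 0 := by linarith
    rcases mul_eq_zero.mp this with h | h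
    · right; right; left; exact ⟨rfl, by linarith⟩
    · right; right; right; left; exact ⟨rfl, by linarith⟩
  · have : (y - 4) * (y + 4) = 0 := by linarith
    rcases mul_eq_zero.mp this with h | h
    · right; right; right; right; left; exact ⟨rfl, by linarith⟩
    · right; right; right; right; right; exact ⟨rfl, by linarith⟩
end
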